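/- arXiv:2210.12376 — 4 statements merged into one kernel-verified Lean document; each statement's English description precedes it below -/
import Mathlib

section
/- Let ℓ ≥ 2 be an integer, let G ∈ 𝒢_ℓ, let x, y be non-adjacent vertices of G, and let P be an induced (x,y)-path of G. If |P| ≤ ℓ and every induced (x,y)-path of G has length |P|, then no block of G contains two non-adjacent vertices of V(P); in particular, every internal vertex of P is a cut-vertex of G. -/
open SimpleGraph

variable {V : Type*}

/-- The list of internal vertices of a walk (its support minus the two ends). -/
def interiorL {G : SimpleGraph V} {a b : V} (p : G.Walk a b) : List V :=
  p.support.tail.dropLast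

/-- `p` is an induced path of `G`: a path such that the only edges of `G` between
vertices of `p` are the edges of `p`. -/
def IsInducedPath (G : SimpleGraph V) {a b : V} (p : G.Walk a b) : Prop :=
  p.IsPath ∧ ∀ x ∈ p.support, ∀ y ∈ p.support, G.Adj x y → s(x, y) ∈ p.edges

/-- A hole of `G`: an induced (chordless) cycle of length at least 4. -/
def IsHole (G : SimpleGraph V) {v : V} (c : G.Walk v v) : Prop :=
  c.IsCycle ∧ 4 ≤ c.length ∧
    ∀ x ∈ c.support, ∀ y ∈ c.support, G.Adj x y → s(x, y) ∈ c.edges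

/-- An odd hole of `G`: a hole of odd length. -/
def IsOddHole (G : SimpleGraph V) {v : V} (c : G.Walk v v) : Prop :=
  IsHole G c ∧ Odd c.length

/-- `G ∈ 𝒢ℓ`: `G` has girth `2ℓ+1` and every odd hole of `G` has length exactly `2ℓ+1`
(equivalently, no odd hole of length at least `2ℓ+3`). -/
def InGFamily (ℓ : ℕ) (G : SimpleGraph V) : Prop :=
  G.egirth = (2 * ℓ + 1 : ℕ) ∧
    ∀ (v : V) (c : G.Walk v v), IsOddHole G c → c.length = 2 * ℓ + 1

/-- `G` is `k`-vertex-critical: `χ(G) = k` and `χ(G − v) < k` for every vertex `v`. -/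
def VertexCritical (k : ℕ) (G : SimpleGraph V) : Prop :=
  G.chromaticNumber = (k : ℕ∞) ∧
    ∀ v : V, (G.induce ({v}ᶜ : Set V)).chromaticNumber < (k : ℕ∞)

/-- An odd `K₄`-subdivision in `G`: four distinct branch vertices `u1, u2, u3, u4`
joined by six internally disjoint paths (the arrises), such that the four face cycles
are all odd holes of `G`. -/
structure OddK4 (G : SimpleGraph V) where
  u1 : V
  u2 : V
  u3 : V
  u4 : V
  /-- the arris joining `u1` and `u2` -/
  P1 : G.Walk u1 u2
  /-- the arris joining `u3` and `u4` -/
  P2 : G.Walk u3 u4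
  /-- the arris joining `u2` and `u3` -/
  Q1 : G.Walk u2 u3
  /-- the arris joining `u1` and `u4` -/
  Q2 : G.Walk u1 u4
  /-- the arris joining `u1` and `u3` -/
  L1 : G.Walk u1 u3
  /-- the arris joining `u2` and `u4` -/
  L2 : G.Walk u2 u4
  hP1 : P1.IsPath
  hP2 : P2.IsPath
  hQ1 : Q1.IsPath
  hQ2 : Q2.IsPath
  hL1 : L1.IsPath
  hL2 : L2.IsPath
  /-- the four branch vertices are pairwise distinct -/
  hnodup : List.Nodup [u1, u2, u3, u4]
  /-- the interiors of the six arrises are pairwise disjoint -/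
  hdisj : List.Pairwise List.Disjoint
    [interiorL P1, interiorL P2, interiorL Q1, interiorL Q2, interiorL L1, interiorL L2]
  /-- no branch vertex lies in the interior of an arris -/
  hbranch : ∀ x ∈ interiorL P1 ++ interiorL P2 ++ interiorL Q1 ++ interiorL Q2 ++
      interiorL L1 ++ interiorL L2, x ∉ [u1, u2, u3, u4]
  /-- the face `u1u2u3` is an odd hole of `G` -/
  face1 : IsOddHole G (P1.append (Q1.append L1.reverse))
  /-- the face `u1u2u4` is an odd hole of `G` -/
  face2 : IsOddHole G (P1.append (L2.append Q2.reverse))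
  /-- the face `u1u3u4` is an odd hole of `G` -/
  face3 : IsOddHole G (L1.append (P2.append Q2.reverse))
  /-- the face `u2u3u4` is an odd hole of `G` -/
  face4 : IsOddHole G (Q1.append (P2.append L2.reverse))

/-- The subgraph of `G` formed by an odd `K₄`-subdivision. -/
def OddK4.toSubgraph {G : SimpleGraph V} (K : OddK4 G) : G.Subgraph :=
  K.P1.toSubgraph ⊔ K.P2.toSubgraph ⊔ K.Q1.toSubgraph ⊔ K.Q2.toSubgraph ⊔
    K.L1.toSubgraph ⊔ K.L2.toSubgraph

/-- The vertex set of an odd `K₄`-subdivision. -/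
def OddK4.verts {G : SimpleGraph V} (K : OddK4 G) : Set V :=
  K.toSubgraph.verts

/-- `X` is a vertex cut of `G`: deleting `X` leaves a disconnected graph. -/
def IsVertexCut (G : SimpleGraph V) (X : Set V) : Prop :=
  ¬ (G.induce (Xᶜ : Set V)).Preconnected

/-- `v` is a cut-vertex (`K₁`-cut) of `G`: some two vertices are connected in `G`
but not in `G − v`. -/
def IsCutVertex (G : SimpleGraph V) (v : V) : Prop :=
  ∃ a b : V, ∃ (ha : a ∈ ({v}ᶜ : Set V)) (hb : b ∈ ({v}ᶜ : Set V)),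
    G.Reachable a b ∧ ¬ (G.induce ({v}ᶜ : Set V)).Reachable ⟨a, ha⟩ ⟨b, hb⟩

/-- `G` has a `K₂`-cut: a pair of adjacent vertices whose deletion disconnects `G`. -/
def HasK2Cut (G : SimpleGraph V) : Prop :=
  ∃ u v : V, G.Adj u v ∧ ¬ (G.induce (({u, v} : Set V)ᶜ)).Preconnected

/-- `G` has a `P₃`-cut: a path on three vertices whose deletion disconnects `G`. -/
def HasP3Cut (G : SimpleGraph V) : Prop :=
  ∃ u v w : V, G.Adj u v ∧ G.Adj v w ∧ u ≠ w ∧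
    ¬ (G.induce (({u, v, w} : Set V)ᶜ)).Preconnected

/-- The closed neighbourhood `N[S]` of a set `S` of vertices. -/
def closedNbhd (G : SimpleGraph V) (S : Set V) : Set V :=
  S ∪ {v | ∃ u ∈ S, G.Adj u v}

/-- `S` is the vertex set of a (connected) component of `G − X`. -/
def IsComponentOf (G : SimpleGraph V) (X S : Set V) : Prop :=
  S.Nonempty ∧ Disjoint S X ∧ (G.induce S).Connected ∧
    ∀ a ∈ S, ∀ b, b ∉ S → b ∉ X → ¬ G.Adj a b

/-- `B` is a block of `G`: a maximal connected subgraph of `G` without a cut-vertex. -/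
def IsBlock (G : SimpleGraph V) (B : G.Subgraph) : Prop :=
  B.Connected ∧ (∀ v : V, ((B.deleteVerts {v}).coe).Preconnected) ∧
    ∀ B' : G.Subgraph, B ≤ B' → B'.Connected →
      (∀ v : V, ((B'.deleteVerts {v}).coe).Preconnected) → B' = B

namespace SimpleGraph

variable {G : SimpleGraph V}

/-- Two distinct paths with the same ends contain a cycle in their union. -/
theorem Walk.IsPath.egirth_le_length_add_length {u v : V} {p q : G.Walk u v} (hp : p.IsPath)
    (hq : q.IsPath) (hpq : p ≠ q) : G.egirth ≤ (p.length + q.length : ℕ) := by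
  classical
  set H : SimpleGraph V := fromEdgeSet {e | e ∈ p.edges ++ q.edges}
  have mem_edgeSet_left : ∀ e ∈ p.edges, e ∈ H.edgeSet := fun e he ↦ by
    simp [H, he, G.not_isDiag_of_mem_edgeSet (p.edges_subset_edgeSet he)]
  have mem_edgeSet_right : ∀ e ∈ q.edges, e ∈ H.edgeSet := fun e he ↦ by
    simp [H, he, G.not_isDiag_of_mem_edgeSet (q.edges_subset_edgeSet he)]
  have hHG : H ≤ G := by
    intro a b hab
    simp only [H, fromEdgeSet_adj, Set.mem_ofPred_eq, List.mem_append] at hab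
    exact hab.1.elim (fun h ↦ p.adj_of_mem_edges h) (fun h ↦ q.adj_of_mem_edges h)
  have hH : ¬ H.IsAcyclic := fun hH ↦ hpq <| by
    have h := (hH.subsingleton_path u v).elim ⟨_, hp.transfer mem_edgeSet_left⟩
      ⟨_, hq.transfer mem_edgeSet_right⟩
    have h' := congrArg (fun r ↦ r.1.support) h
    simp only [Walk.support_transfer] at h'
    exact Walk.ext_support h'
  obtain ⟨a, c, hc⟩ : ∃ (a : V) (c : H.Walk a a), c.IsCycle := by
    simpa [IsAcyclic] using hH
  have hlen : c.length ≤ p.length + q.length := by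
    have hsub : c.edges ⊆ p.edges ++ q.edges := fun e he ↦ by
      have := c.edges_subset_edgeSet he
      simp only [H, edgeSet_fromEdgeSet] at this
      exact this.1
    simpa using (hc.edges_nodup.subperm hsub).length_le
  calc G.egirth ≤ (c.mapLe hHG).length := egirth_le_length (hc.mapLe hHG)
    _ ≤ (p.length + q.length : ℕ) := by simpa using by exact_mod_cast hlen

/-- The image of a walk under a homomorphism stays in the range of that homomorphism. -/
theorem Reachable.exists_walk_support_subset_range {W : Type*} {H : SimpleGraph W} (f : H →g G)
    {a b : W} (h : H.Reachable a b) :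
    ∃ w : G.Walk (f a) (f b), ∀ z ∈ w.support, z ∈ Set.range f := by
  obtain ⟨w⟩ := h
  refine ⟨w.map f, fun z hz ↦ ?_⟩
  rw [Walk.support_map, List.mem_map] at hz
  obtain ⟨c, -, rfl⟩ := hz
  exact ⟨c, rfl⟩

/-- If some `x`-`y` walk avoids `v`, then so does some induced `x`-`y` path. -/
theorem Walk.exists_isInducedPath_notMem_support {x y v : V} (W : G.Walk x y)
    (hW : v ∉ W.support) : ∃ Q : G.Walk x y, IsInducedPath G Q ∧ v ∉ Q.support := by
  classical
  have hex : ∃ n, ∃ Q : G.Walk x y, v ∉ Q.support ∧ Q.length = n := ⟨_, W, hW, rfl⟩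
  obtain ⟨R, hR, hRn⟩ := Nat.find_spec hex
  have hmin : ∀ Q : G.Walk x y, v ∉ Q.support → R.bypass.length ≤ Q.length := fun Q hQ ↦
    (R.length_bypass_le_length.trans hRn.le).trans (Nat.find_min' hex ⟨Q, hQ, rfl⟩)
  have hQv : v ∉ R.bypass.support := fun h ↦ hR (R.support_bypass_subset_support h)
  have hQp : R.bypass.IsPath := R.bypass_isPath
  generalize R.bypass = Q at hmin hQv hQp
  have key : ∀ i j, i < j → j ≤ Q.length → G.Adj (Q.getVert i) (Q.getVert j) →
      s(Q.getVert i, Q.getVert j) ∈ Q.edges := by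
    intro i j hij hj hadj
    rcases (Nat.succ_le_of_lt hij).eq_or_lt with rfl | h
    · exact Q.mem_edges_toSubgraph.mp (Q.toSubgraph_adj_getVert hj)
    · have hv : v ∉ ((Q.take i).append (Walk.cons hadj (Q.drop j))).support := by
        simp only [Walk.mem_support_append_iff, Walk.support_cons, List.mem_cons, not_or]
        exact ⟨fun h ↦ hQv ((Q.isSubwalk_take i).support_subset h),
          fun h ↦ hQv (h ▸ Q.getVert_mem_support i),
          fun h ↦ hQv ((Q.isSubwalk_drop j).support_subset h)⟩
      have := hmin _ hv
      simp only [Walk.length_append, Walk.length_cons, Walk.take_length, Walk.drop_length] at this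
      omega
  refine ⟨Q, ⟨hQp, fun a ha b hb hab ↦ ?_⟩, hQv⟩
  obtain ⟨i, rfl, hi⟩ := Walk.mem_support_iff_exists_getVert.mp ha
  obtain ⟨j, rfl, hj⟩ := Walk.mem_support_iff_exists_getVert.mp hb
  rcases lt_trichotomy i j with h | rfl | h
  · exact key i j h hj hab
  · exact (hab.ne rfl).elim
  · rw [Sym2.eq_swap]
    exact key j i h hi hab.symm

/-- If a path is shorter than half the girth and has the length of every induced path between
its ends, then every walk between its ends visits all of its vertices. -/
theorem Walk.IsPath.support_subset_of_two_mul_length_lt_egirth {x y : V} {P : G.Walk x y}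
    (hP : P.IsPath) (hlen : (2 * P.length : ℕ) < G.egirth)
    (hall : ∀ Q : G.Walk x y, IsInducedPath G Q → Q.length = P.length) (W : G.Walk x y) :
    P.support ⊆ W.support := by
  intro v hv
  by_contra hW
  obtain ⟨Q, hQ, hQv⟩ := W.exists_isInducedPath_notMem_support hW
  have hne : P ≠ Q := fun h ↦ hQv (h ▸ hv)
  have h := hP.egirth_le_length_add_length hQ.1 hne
  rw [hall Q hQ, ← two_mul] at h
  exact absurd hlen h.not_gt

end SimpleGraph

/-- Lemma 2.4: let `x, y` be non-adjacent vertices of `G ∈ 𝒢ℓ` and `P`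
an induced `(x,y)`-path. If `|P| ≤ ℓ` and all induced `(x,y)`-paths have length `|P|`,
then no block of `G` contains two non-adjacent vertices of `V(P)`; in particular each
internal vertex of `P` is a cut-vertex of `G`. -/
theorem block_and_cut_vertices {V : Type*} (ℓ : ℕ) (hℓ : 2 ≤ ℓ) (G : SimpleGraph V)
    (hG : InGFamily ℓ G) (x y : V) (hne : x ≠ y) (hnadj : ¬ G.Adj x y)
    (P : G.Walk x y) (hP : IsInducedPath G P) (hlen : P.length ≤ ℓ)
    (hall : ∀ Q : G.Walk x y, IsInducedPath G Q → Q.length = P.length) :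
    (∀ B : G.Subgraph, IsBlock G B → ∀ u ∈ P.support, ∀ w ∈ P.support,
        u ∈ B.verts → w ∈ B.verts → ¬ G.Adj u w → u = w) ∧
      ∀ v ∈ interiorL P, IsCutVertex G v := by
  have hgirth : (2 * P.length : ℕ) < G.egirth := by
    rw [hG.1]
    exact_mod_cast (by omega : 2 * P.length < 2 * ℓ + 1)
  have hsub := hP.1.support_subset_of_two_mul_length_lt_egirth hgirth hall
  constructor
  · intro B hB
    have key : ∀ i j, i < j → j ≤ P.length → P.getVert i ∈ B.verts → P.getVert j ∈ B.verts →
        G.Adj (P.getVert i) (P.getVert j) := by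
      intro i j hij hj hi hjB
      by_contra hadj
      have hij' : i + 1 < j := by
        refine lt_of_le_of_ne hij ?_
        rintro rfl
        exact hadj (P.adj_getVert_succ hj)
      have hinj : ∀ m n, m ≤ P.length → n ≤ P.length → P.getVert m = P.getVert n → m = n :=
        fun m n hm hn h ↦ hP.1.getVert_injOn hm hn h
      have hvi : P.getVert i ≠ P.getVert (i + 1) := fun h ↦ by
        have := hinj _ _ (by omega) (by omega) h
        omega
      have hvj : P.getVert j ≠ P.getVert (i + 1) := fun h ↦ by
        have := hinj _ _ (by omega) (by omega) h
        omega
      obtain ⟨w, hw⟩ : ∃ w : G.Walk (P.getVert i) (P.getVert j),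
          ∀ z ∈ w.support, z ∈ Set.range (B.deleteVerts {P.getVert (i + 1)}).hom :=
        Reachable.exists_walk_support_subset_range (B.deleteVerts {P.getVert (i + 1)}).hom <|
          hB.2.1 (P.getVert (i + 1)) ⟨P.getVert i, by simpa using ⟨hi, hvi⟩⟩
            ⟨P.getVert j, by simpa using ⟨hjB, hvj⟩⟩
      have hmem := hsub ((P.take i).append (w.append (P.drop j)))
        (P.getVert_mem_support (i + 1))
      simp only [Walk.mem_support_append_iff] at hmem
      rcases hmem with h | h | h
      · obtain ⟨n, hn, hn'⟩ := Walk.mem_support_iff_exists_getVert.mp h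
        rw [Walk.take_getVert] at hn
        have := hinj _ _ (by omega) (by omega) hn
        omega
      · obtain ⟨a, ha⟩ := hw _ h
        exact a.2.2 ha
      · obtain ⟨n, hn, hn'⟩ := Walk.mem_support_iff_exists_getVert.mp h
        rw [Walk.drop_length] at hn'
        rw [Walk.drop_getVert] at hn
        have := hinj _ _ (by omega) (by omega) hn
        omega
    intro u hu w hw huB hwB hadj
    obtain ⟨i, rfl, hi⟩ := Walk.mem_support_iff_exists_getVert.mp hu
    obtain ⟨j, rfl, hj⟩ := Walk.mem_support_iff_exists_getVert.mp hw
    rcases lt_trichotomy i j with h | rfl | h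
    · exact (hadj (key i j h hj huB hwB)).elim
    · rfl
    · exact (hadj (key j i h hi hwB huB).symm).elim
  · intro v hv
    have hvt : v ∈ P.support.tail := List.mem_of_mem_dropLast hv
    have hxv : x ≠ v := by
      rintro rfl
      have h := hP.1.support_nodup
      rw [← Walk.cons_tail_support, List.nodup_cons] at h
      exact h.1 hvt
    have hyv : y ≠ v := by
      rintro rfl
      have ht : P.support.tail ≠ [] := List.ne_nil_of_mem hvt
      have hlast : P.support.tail.getLast ht = y := by
        rw [List.getLast_tail, Walk.getLast_support]
      have h := hP.1.support_nodup.tail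
      rw [← List.dropLast_append_getLast ht, hlast, List.nodup_append] at h
      exact h.2.2 _ hv _ (by simp) rfl
    refine ⟨x, y, hxv, hyv, ⟨P⟩, fun hreach ↦ ?_⟩
    obtain ⟨w, hw⟩ : ∃ w : G.Walk x y,
        ∀ z ∈ w.support, z ∈ Set.range (Embedding.induce (G := G) {v}ᶜ).toHom :=
      hreach.exists_walk_support_subset_range (Embedding.induce {v}ᶜ).toHom
    obtain ⟨a, ha⟩ := hw _ (hsub w (List.mem_of_mem_tail hvt))
    exact a.2 ha
end

section
/- Let ℓ ≥ 2 be an integer and let G ∈ 𝒢_ℓ have an odd K4-subdivision H. Then each pair of vertex-disjoint arrises of H have the same length, and every arris of H has length at most ℓ. -/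
open SimpleGraph

variable {V : Type*}

/-- Two distinct paths with the same ends span a cycle no longer than their total length. -/
theorem egirth_le_of_isPath_ne {G : SimpleGraph V} {a b : V} {p q : G.Walk a b}
    (hp : p.IsPath) (hq : q.IsPath) (hne : p ≠ q) :
    G.egirth ≤ (p.length + q.length : ℕ) := by
  classical
  let s : Finset (Sym2 V) := p.edges.toFinset ∪ q.edges.toFinset
  let H : SimpleGraph V := fromEdgeSet (s : Set (Sym2 V))
  have edge_mem : ∀ e ∈ G.edgeSet, e ∈ s → e ∈ H.edgeSet := fun e he hs ↦ by
    simpa [H, edgeSet_fromEdgeSet] using ⟨hs, G.not_isDiag_of_mem_edgeSet he⟩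
  have hpH : ∀ e ∈ p.edges, e ∈ H.edgeSet := fun e he ↦
    edge_mem e (p.edges_subset_edgeSet he) (by simp [s, he])
  have hqH : ∀ e ∈ q.edges, e ∈ H.edgeSet := fun e he ↦
    edge_mem e (q.edges_subset_edgeSet he) (by simp [s, he])
  have mem_s : ∀ e ∈ H.edgeSet, e ∈ s := fun e he ↦ by
    simp only [H, edgeSet_fromEdgeSet] at he
    exact he.1
  have hcyc : ¬ H.IsAcyclic := fun h ↦ hne <| by
    have heq := congrArg Subtype.val <| (h.subsingleton_path a b).elim
      ⟨p.transfer H hpH, hp.transfer hpH⟩ ⟨q.transfer H hqH, hq.transfer hqH⟩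
    exact Walk.ext_support (by simpa using congrArg Walk.support heq)
  simp only [IsAcyclic, not_forall, not_not] at hcyc
  obtain ⟨v, c, hc⟩ := hcyc
  have hcG : ∀ e ∈ c.edges, e ∈ G.edgeSet := fun e he ↦ by
    have hs := mem_s e (c.edges_subset_edgeSet he)
    simp only [s, Finset.mem_union, List.mem_toFinset] at hs
    exact hs.elim (p.edges_subset_edgeSet ·) (q.edges_subset_edgeSet ·)
  refine (egirth_le_length (hc.transfer hcG)).trans ?_
  rw [Nat.cast_le, Walk.length_transfer]
  calc c.length = c.edges.toFinset.card := by
        rw [List.toFinset_card_of_nodup hc.edges_nodup, Walk.length_edges]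
    _ ≤ s.card := Finset.card_le_card fun e he ↦
        mem_s e (c.edges_subset_edgeSet (List.mem_toFinset.mp he))
    _ ≤ p.length + q.length := (Finset.card_union_le _ _).trans <| by
        simpa using Nat.add_le_add p.edges.toFinset_card_le q.edges.toFinset_card_le

theorem mem_interiorL_of_mem_support {G : SimpleGraph V} {a b x : V} {p : G.Walk a b}
    (hx : x ∈ p.support) (ha : x ≠ a) (hb : x ≠ b) : x ∈ interiorL p := by
  rw [interiorL]
  have htail : x ∈ p.support.tail := (p.mem_support_iff.mp hx).resolve_left ha
  have hne : p.support.tail ≠ [] := List.ne_nil_of_mem htail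
  rw [← List.dropLast_append_getLast hne] at htail
  simpa [List.getLast_tail, hb] using htail

/-- Lemma 2.6 (1): in an odd `K₄`-subdivision of `G ∈ 𝒢ℓ`, each pair of
vertex-disjoint arrises have the same length, and all arrises have length at most `ℓ`. -/
theorem oddK4_arris_lengths {V : Type*} (ℓ : ℕ) (hℓ : 2 ≤ ℓ) (G : SimpleGraph V)
    (hG : InGFamily ℓ G) (K : OddK4 G) :
    K.P1.length = K.P2.length ∧ K.Q1.length = K.Q2.length ∧ K.L1.length = K.L2.length ∧
      K.P1.length ≤ ℓ ∧ K.P2.length ≤ ℓ ∧ K.Q1.length ≤ ℓ ∧ K.Q2.length ≤ ℓ ∧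
      K.L1.length ≤ ℓ ∧ K.L2.length ≤ ℓ := by
  have hlen : ∀ {v : V} {c : G.Walk v v}, IsOddHole G c → c.length = 2 * ℓ + 1 := hG.2 _ _
  have h1 := hlen K.face1
  have h2 := hlen K.face2
  have h3 := hlen K.face3
  have h4 := hlen K.face4
  simp only [Walk.length_append, Walk.length_reverse] at h1 h2 h3 h4
  obtain ⟨⟨h12, h13, h14⟩, ⟨h23, h24⟩, h34⟩ :
      (K.u1 ≠ K.u2 ∧ K.u1 ≠ K.u3 ∧ K.u1 ≠ K.u4) ∧ (K.u2 ≠ K.u3 ∧ K.u2 ≠ K.u4) ∧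
        K.u3 ≠ K.u4 := by
    simpa using K.hnodup
  have hbranch := K.hbranch
  have hP2 : K.u2 ∉ K.P2.support := fun h ↦
    hbranch K.u2 (by simp [mem_interiorL_of_mem_support h h23 h24]) (by simp)
  have hL1 : K.u2 ∉ K.L1.support := fun h ↦
    hbranch K.u2 (by simp [mem_interiorL_of_mem_support h h12.symm h23]) (by simp)
  have hQ2 : K.u2 ∉ K.Q2.support := fun h ↦
    hbranch K.u2 (by simp [mem_interiorL_of_mem_support h h12.symm h24]) (by simp)
  have hQ1 : K.u4 ∉ K.Q1.support := fun h ↦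
    hbranch K.u4 (by simp [mem_interiorL_of_mem_support h h24.symm h34.symm]) (by simp)
  have hL1' : K.u4 ∉ K.L1.support := fun h ↦
    hbranch K.u4 (by simp [mem_interiorL_of_mem_support h h14.symm h34.symm]) (by simp)
  have girth_le : ∀ {a b x : V} {p q : G.Walk a b}, p.IsPath → q.IsPath → x ∈ p.support →
      x ∉ q.support → 2 * ℓ + 1 ≤ p.length + q.length := fun hp hq hxp hxq ↦ by
    have h := egirth_le_of_isPath_ne hp hq fun h ↦ hxq (h ▸ hxp)
    rw [hG.1] at h
    exact_mod_cast h
  have hP := girth_le (x := K.u4)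
    (K.face2.1.1.isPath_of_append_right (Walk.not_nil_of_ne h12))
    (K.face1.1.1.isPath_of_append_right (Walk.not_nil_of_ne h12))
    (by simp) (by simp [Walk.mem_support_append_iff, hQ1, hL1'])
  have hQ := girth_le (x := K.u2) (p := K.P1.append K.L2) (q := K.L1.append K.P2)
    (Walk.IsCycle.isPath_of_append_left (q := K.Q2.reverse) (Walk.not_nil_of_ne h14.symm)
      (by rw [← Walk.append_assoc]; exact K.face2.1.1))
    (Walk.IsCycle.isPath_of_append_left (q := K.Q2.reverse) (Walk.not_nil_of_ne h14.symm)
      (by rw [← Walk.append_assoc]; exact K.face3.1.1))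
    (by simp) (by simp [Walk.mem_support_append_iff, hL1, hP2])
  have hL := girth_le (x := K.u2) (p := K.P1.append K.Q1) (q := (K.P2.append K.Q2.reverse).reverse)
    (Walk.IsCycle.isPath_of_append_left (q := K.L1.reverse) (Walk.not_nil_of_ne h13.symm)
      (by rw [← Walk.append_assoc]; exact K.face1.1.1))
    (K.face3.1.1.isPath_of_append_right (Walk.not_nil_of_ne h13)).reverse
    (by simp) (by simp [Walk.mem_support_append_iff, hQ2, hP2])
  simp only [Walk.length_append, Walk.length_reverse] at hP hQ hL
  lia
end

section
/- Let ℓ ≥ 2 be an integer and let G ∈ 𝒢_ℓ have an odd K4-subdivision H. Then H is an induced subgraph of G. -/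
open SimpleGraph

variable {V : Type*}

namespace SimpleGraph.Walk

variable {G : SimpleGraph V}

/-- A walk joining the ends of an edge without using it closes up to a cycle. -/
theorem egirth_le_length_add_one {x y : V} (hxy : G.Adj x y) (w : G.Walk y x)
    (hw : s(x, y) ∉ w.edges) : G.egirth ≤ (w.length + 1 : ℕ) := by
  classical
  have hc : (cons hxy w.bypass).IsCycle :=
    Path.cons_isCycle ⟨w.bypass, w.bypass_isPath⟩ hxy fun h => hw (w.edges_bypass_subset_edges h)
  refine (egirth_le_length hc).trans ?_
  rw [length_cons]
  exact_mod_cast Nat.add_le_add_right w.length_bypass_le_length 1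

/-- A walk splits at each of its vertices. -/
theorem exists_split {u v x : V} (w : G.Walk u v) (hx : x ∈ w.support) :
    ∃ (a : G.Walk u x) (b : G.Walk x v), a.length + b.length = w.length ∧
      a.edges ⊆ w.edges ∧ b.edges ⊆ w.edges := by
  obtain ⟨a, b, rfl⟩ := mem_support_iff_exists_append.mp hx
  exact ⟨a, b, by simp, by simp [edges_append], by simp [edges_append]⟩

end SimpleGraph.Walk

/-- In a graph of girth `2ℓ+1`, consider a `K₄`-shaped system of walks in which opposite walks
have equal lengths and each face has length `2ℓ+1`. Then every edge between two opposite walks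
belongs to one of the six walks. -/
theorem mem_edges_of_adj_opposite {G : SimpleGraph V} {ℓ : ℕ}
    (hG : G.egirth = (2 * ℓ + 1 : ℕ)) {u1 u2 u3 u4 x y : V}
    (P1 : G.Walk u1 u2) (P2 : G.Walk u3 u4) (Q1 : G.Walk u2 u3) (Q2 : G.Walk u1 u4)
    (L1 : G.Walk u1 u3) (L2 : G.Walk u2 u4)
    (hP : P1.length = P2.length) (hQ : Q1.length = Q2.length) (hL : L1.length = L2.length)
    (hsum : P1.length + Q1.length + L1.length = 2 * ℓ + 1)
    (hQ0 : Q1.length ≠ 0) (hL0 : L1.length ≠ 0)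
    (hx : x ∈ P1.support) (hy : y ∈ P2.support) (hxy : G.Adj x y) :
    s(x, y) ∈ P1.edges ∨ s(x, y) ∈ P2.edges ∨ s(x, y) ∈ Q1.edges ∨
      s(x, y) ∈ Q2.edges ∨ s(x, y) ∈ L1.edges ∨ s(x, y) ∈ L2.edges := by
  by_contra! h
  obtain ⟨hP1, hP2, hQ1, hQ2, hL1, hL2⟩ := h
  obtain ⟨a, a', ha, hae, hae'⟩ := P1.exists_split hx
  obtain ⟨b, b', hb, hbe, hbe'⟩ := P2.exists_split hy
  have girth_le (w : G.Walk x y) (hw : s(x, y) ∉ w.edges) : 2 * ℓ + 1 ≤ w.length + 1 := by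
    have := Walk.egirth_le_length_add_one hxy w.reverse (by simpa using hw)
    rw [hG, Walk.length_reverse] at this
    exact_mod_cast this
  have na := mt (@hae _) hP1
  have na' := mt (@hae' _) hP1
  have nb := mt (@hbe _) hP2
  have nb' := mt (@hbe' _) hP2
  have h1 := girth_le (a.reverse.append (L1.append b)) (by simp [Walk.edges_append, *])
  have h2 := girth_le (a.reverse.append (Q2.append b'.reverse)) (by simp [Walk.edges_append, *])
  have h3 := girth_le (a'.append (Q1.append b)) (by simp [Walk.edges_append, *])
  have h4 := girth_le (a'.append (L2.append b'.reverse)) (by simp [Walk.edges_append, *])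
  simp only [Walk.length_append, Walk.length_reverse] at h1 h2 h3 h4
  omega

/-- Lemma 2.6 (2): every odd `K₄`-subdivision of `G ∈ 𝒢ℓ` is an induced
subgraph of `G`. -/
theorem oddK4_is_induced {V : Type*} (ℓ : ℕ) (hℓ : 2 ≤ ℓ) (G : SimpleGraph V)
    (hG : InGFamily ℓ G) (K : OddK4 G) :
    K.toSubgraph.IsInduced := by
  obtain ⟨hgirth, hodd⟩ := hG
  obtain ⟨u1, u2, u3, u4, P1, P2, Q1, Q2, L1, L2, -, -, -, -, -, -, hne, -, -, f1, f2, f3, f4⟩ := K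
  have e1 := hodd _ _ f1
  have e2 := hodd _ _ f2
  have e3 := hodd _ _ f3
  have e4 := hodd _ _ f4
  replace f1 := f1.1.2.2
  replace f2 := f2.1.2.2
  replace f3 := f3.1.2.2
  replace f4 := f4.1.2.2
  simp only [Walk.length_append, Walk.length_reverse] at e1 e2 e3 e4
  simp only [Walk.mem_support_append_iff, Walk.support_reverse, List.mem_reverse,
    Walk.edges_append, Walk.edges_reverse, List.mem_append] at f1 f2 f3 f4
  have hP0 : P1.length ≠ 0 := fun h => by simp [Walk.eq_of_length_eq_zero h] at hne
  have hQ0 : Q1.length ≠ 0 := fun h => by simp [Walk.eq_of_length_eq_zero h] at hne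
  have hL0 : L1.length ≠ 0 := fun h => by simp [Walk.eq_of_length_eq_zero h] at hne
  have hPP (x y) := mem_edges_of_adj_opposite (x := x) (y := y) hgirth P1 P2 Q1 Q2 L1 L2
    (by omega) (by omega) (by omega) (by omega) hQ0 hL0
  have hQQ (x y) := mem_edges_of_adj_opposite (x := x) (y := y) hgirth Q1 Q2 L1.reverse L2
    P1.reverse P2 (by omega) (by simp; omega) (by simp; omega) (by simp; omega)
    (by simpa using hL0) (by simpa using hP0)
  have hLL (x y) := mem_edges_of_adj_opposite (x := x) (y := y) hgirth L1 L2 Q1.reverse Q2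
    P1 P2 (by omega) (by simp; omega) (by omega) (by simp; omega)
    (by simpa using hQ0) hP0
  simp only [Walk.edges_reverse, List.mem_reverse] at hQQ hLL
  intro x hx y hy hxy
  simp only [OddK4.toSubgraph, Subgraph.verts_sup, Set.mem_union, Walk.mem_verts_toSubgraph,
    Subgraph.sup_adj, Walk.adj_toSubgraph_iff_mem_edges] at hx hy ⊢
  have hPP' := hPP y x
  have hQQ' := hQQ y x
  have hLL' := hLL y x
  rw [Sym2.eq_swap] at hPP' hQQ' hLL'
  specialize hPP x y
  specialize hQQ x y
  specialize hLL x y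
  specialize f1 x
  specialize f2 x
  specialize f3 x
  specialize f4 x
  have hyx := hxy.symm
  grind
end

section
/- In the setup below, the vertex x does not belong to {u1, u2}. -/
open SimpleGraph

variable {V : Type*}

/-- `P1, P2` form a pair of longest arrises of the odd `K₄`-subdivision `K`. -/
def OddK4.longestPair {G : SimpleGraph V} (K : OddK4 G) : Prop :=
  K.Q1.length ≤ K.P1.length ∧ K.Q2.length ≤ K.P1.length ∧
    K.L1.length ≤ K.P1.length ∧ K.L2.length ≤ K.P1.length ∧
    K.Q1.length ≤ K.P2.length ∧ K.Q2.length ≤ K.P2.length ∧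
    K.L1.length ≤ K.P2.length ∧ K.L2.length ≤ K.P2.length

/-- The difference `d(H) = |P1| − min(|Q1|, |L1|)` of an odd `K₄`-subdivision
(labelled so that `P1, P2` is a pair of longest arrises). -/
def OddK4.diff {G : SimpleGraph V} (K : OddK4 G) : ℕ :=
  K.P1.length - min K.Q1.length K.L1.length

namespace SimpleGraph.Walk

variable {G : SimpleGraph V}

lemma IsPath.append_of_support_inter {a b c : V} {p : G.Walk a b} {q : G.Walk b c}
    (hp : p.IsPath) (hq : q.IsPath) (h : ∀ z ∈ p.support, z ∈ q.support → z = b) :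
    (p.append q).IsPath := by
  rw [isPath_def, support_append, List.nodup_append']
  have hq' := hq.support_nodup
  rw [← cons_tail_support, List.nodup_cons] at hq'
  refine ⟨hp.support_nodup, hq'.2, fun z hz hz' => ?_⟩
  obtain rfl := h z hz (List.mem_of_mem_tail hz')
  exact hq'.1 hz'

lemma mem_interiorL_of_mem_support {a b z : V} {p : G.Walk a b} (hz : z ∈ p.support)
    (ha : z ≠ a) (hb : z ≠ b) : z ∈ interiorL p := by
  rw [mem_support_iff] at hz
  have hz := hz.resolve_left ha
  have hne : p.support.tail ≠ [] := List.ne_nil_of_mem hz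
  have hl : p.support.tail.getLast hne = b := by
    rw [List.getLast_tail, getLast_support]
  rw [← List.dropLast_append_getLast hne, List.mem_append, hl] at hz
  exact hz.resolve_right (by simpa using hb)

lemma mem_support_of_mem_interiorL {a b z : V} {p : G.Walk a b} (hz : z ∈ interiorL p) :
    z ∈ p.support :=
  List.mem_of_mem_tail (List.mem_of_mem_dropLast hz)

lemma egirth_le_of_adj {a b : V} (h : G.Adj a b) (w : G.Walk b a) (hw : s(a, b) ∉ w.edges) :
    G.egirth ≤ (w.length + 1 : ℕ) := by
  classical
  have hc : (cons h w.bypass).IsCycle := (cons_isCycle_iff _ _).2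
    ⟨w.bypass_isPath, fun he => hw (w.edges_bypass_subset_edges he)⟩
  refine (egirth_le_length hc).trans ?_
  rw [length_cons]
  exact_mod_cast Nat.succ_le_succ w.length_bypass_le_length

end SimpleGraph.Walk

namespace IsInducedPath

variable {G : SimpleGraph V}

lemma reverse {a b : V} {p : G.Walk a b} (h : IsInducedPath G p) : IsInducedPath G p.reverse := by
  refine ⟨h.1.reverse, fun x hx y hy hxy => ?_⟩
  simp only [Walk.support_reverse, List.mem_reverse, Walk.edges_reverse] at *
  exact h.2 x hx y hy hxy

lemma append_append {a b c d : V} {p : G.Walk a b} {q : G.Walk b c} {r : G.Walk c d}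
    (hpq : IsInducedPath G (p.append q)) (hqr : IsInducedPath G (q.append r))
    (hdisj : ∀ s ∈ p.support, s ∉ r.support)
    (hadj : ∀ s ∈ p.support, ∀ t ∈ r.support, G.Adj s t → s = b ∨ t = c) :
    IsInducedPath G ((p.append q).append r) := by
  have hcross : ∀ s ∈ p.support, ∀ t ∈ r.support, G.Adj s t →
      s(s, t) ∈ (p.append q).edges ∨ s(s, t) ∈ (q.append r).edges := by
    intro s hs t ht hst
    rcases hadj s hs t ht hst with rfl | rfl
    · exact .inr (hqr.2 _ (by simp) _ (by simp [ht]) hst)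
    · exact .inl (hpq.2 _ (by simp [hs]) _ (by simp) hst)
  refine ⟨hpq.1.append_of_support_inter hqr.1.of_append_right fun z hz hz' => ?_, ?_⟩
  · rw [Walk.mem_support_append_iff] at hz
    rcases hz with hz | hz
    · exact absurd hz' (hdisj z hz)
    · by_contra hne
      have := hqr.1.support_nodup
      rw [Walk.support_append, List.nodup_append'] at this
      rw [Walk.mem_support_iff] at hz'
      exact this.2.2 hz (hz'.resolve_left hne)
  · intro x hx y hy hxy
    have h1 := hpq.2 x
    have h2 := hqr.2 x
    have h3 := hcross x
    have h4 := hcross y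
    simp only [Walk.mem_support_append_iff, Walk.edges_append, List.mem_append] at *
    have h5 := @Sym2.eq_swap V x y
    grind [G.adj_comm]

/-- Closing an induced path by a second one that touches it only at the ends gives a hole. -/
lemma isHole_cons_append {v1 v2 x y : V} {p : G.Walk v1 v2} {r : G.Walk x y}
    (hp : IsInducedPath G p) (hr : IsInducedPath G r) (hdisj : ∀ w ∈ p.support, w ∉ r.support)
    (hx : G.Adj x v1) (hy : G.Adj v2 y) (hlen : 2 ≤ r.length)
    (hadj : ∀ w ∈ p.support, ∀ z ∈ r.support, G.Adj w z → w = v1 ∧ z = x ∨ w = v2 ∧ z = y) :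
    IsHole G (.cons hx (p.append (.cons hy r.reverse))) := by
  have hyx : y ≠ x := by
    rintro rfl
    have := (Walk.isPath_iff_nil.1 hr.1).eq_nil
    simp [this] at hlen
  refine ⟨(Walk.cons_isCycle_iff _ _).2 ⟨?_, ?_⟩, ?_, ?_⟩
  · refine hp.1.append_of_support_inter ?_ ?_
    · rw [Walk.cons_isPath_iff]
      exact ⟨hr.1.reverse, by simpa using hdisj v2 (by simp)⟩
    · intro z hz hz'
      simp only [Walk.support_cons, Walk.support_reverse, List.mem_cons, List.mem_reverse] at hz'
      exact hz'.resolve_right (hdisj z hz)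
  · simp only [Walk.edges_append, Walk.edges_cons, Walk.edges_reverse, List.mem_append,
      List.mem_cons, List.mem_reverse, not_or]
    refine ⟨fun h => ?_, fun h => ?_, fun h => ?_⟩
    · exact hdisj x (p.fst_mem_support_of_mem_edges h) (by simp)
    · have := hdisj v2 (by simp)
      rw [Sym2.eq_iff] at h
      rcases h with ⟨rfl, -⟩ | ⟨rfl, -⟩
      · exact this (by simp)
      · exact hyx rfl
    · exact hdisj v1 (by simp) (r.snd_mem_support_of_mem_edges h)
  · simp only [Walk.length_cons, Walk.length_append, Walk.length_reverse]
    omega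
  · intro a ha b hb hab
    have h1 := hp.2 a
    have h2 := hr.2 a
    have h3 := hadj a
    have h4 := hadj b
    have h5 := p.start_mem_support
    have h6 := r.start_mem_support
    simp only [Walk.support_cons, Walk.support_append, Walk.support_reverse, Walk.edges_cons,
      Walk.edges_append, Walk.edges_reverse, List.mem_cons, List.mem_append, List.mem_reverse,
      List.tail_cons, Sym2.eq_iff] at *
    grind [G.adj_comm]

end IsInducedPath

namespace IsHole

variable {G : SimpleGraph V}

lemma reverse {a : V} {c : G.Walk a a} (h : IsHole G c) : IsHole G c.reverse := by
  refine ⟨h.1.reverse, by simpa using h.2.1, fun x hx y hy hxy => ?_⟩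
  simp only [Walk.support_reverse, List.mem_reverse, Walk.edges_reverse] at *
  exact h.2.2 x hx y hy hxy

lemma append_comm {a b : V} {p : G.Walk a b} {q : G.Walk b a} (h : IsHole G (p.append q)) :
    IsHole G (q.append p) := by
  obtain ⟨hc, hl, hi⟩ := h
  refine ⟨?_, ?_, fun x hx y hy hxy => ?_⟩
  · rw [Walk.isCycle_def, Walk.isTrail_def] at hc ⊢
    rw [Walk.edges_append, Walk.tail_support_append] at hc ⊢
    refine ⟨List.nodup_append_comm.1 hc.1, fun h => ?_, List.nodup_append_comm.1 hc.2.2⟩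
    have := congrArg Walk.length h
    simp only [Walk.length_append, Walk.length_nil] at this hl
    omega
  · simp only [Walk.length_append] at hl ⊢
    omega
  · have := hi x
    simp only [Walk.mem_support_append_iff, Walk.edges_append, List.mem_append] at *
    grind

lemma isInducedPath_left {a b : V} {p : G.Walk a b} {q : G.Walk b a} (h : IsHole G (p.append q))
    (hq : 2 ≤ q.length) : IsInducedPath G p := by
  obtain ⟨hc, hl, hi⟩ := h
  have hqn : ¬ q.Nil := fun h => by simp [Walk.length_eq_zero_iff.2 h] at hq
  refine ⟨hc.isPath_of_append_left hqn, fun x hx y hy hxy => ?_⟩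
  have he := hi x (by simp [hx]) y (by simp [hy]) hxy
  rw [Walk.edges_append, List.mem_append] at he
  refine he.resolve_right fun he => ?_
  have hnd := hc.support_nodup
  rw [Walk.tail_support_append, List.nodup_append'] at hnd
  have key : ∀ z ∈ p.support, z ∈ q.support → z = a ∨ z = b := by
    intro z hz hz'
    rw [Walk.mem_support_iff] at hz hz'
    by_contra hne
    rw [not_or] at hne
    exact hnd.2.2 (hz.resolve_left hne.1) (hz'.resolve_left hne.2)
  have hxy' := hxy.ne
  have hab : a ≠ b ∧ s(b, a) ∈ q.edges := by
    have h1 := key x hx (q.fst_mem_support_of_mem_edges he)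
    have h2 := key y hy (q.snd_mem_support_of_mem_edges he)
    have h3 : s(x, y) = s(y, x) := Sym2.eq_swap
    grind
  have hpn : ¬ p.Nil := fun h => hab.1 h.eq
  have := (hc.isPath_of_append_right hpn).length_eq_one_of_mem_edges hab.2
  omega

end IsHole

namespace OddK4

variable {G : SimpleGraph V} (K : OddK4 G) {ℓ : ℕ}

lemma mem_verts {z : V} : z ∈ K.verts ↔ z ∈ K.P1.support ∨ z ∈ K.P2.support ∨ z ∈ K.Q1.support ∨
    z ∈ K.Q2.support ∨ z ∈ K.L1.support ∨ z ∈ K.L2.support := by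
  simp [verts, toSubgraph, or_assoc]

lemma branch_ne : K.u1 ≠ K.u2 ∧ K.u1 ≠ K.u3 ∧ K.u1 ≠ K.u4 ∧ K.u2 ≠ K.u3 ∧ K.u2 ≠ K.u4 ∧
    K.u3 ≠ K.u4 := by
  have := K.hnodup
  simp only [List.nodup_cons, List.mem_cons, List.not_mem_nil, or_false, not_or] at this
  tauto

lemma length_pos : 0 < K.P1.length ∧ 0 < K.P2.length ∧ 0 < K.Q1.length ∧ 0 < K.Q2.length ∧
    0 < K.L1.length ∧ 0 < K.L2.length := by
  have := K.branch_ne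
  refine ⟨?_, ?_, ?_, ?_, ?_, ?_⟩ <;>
  · refine Nat.pos_of_ne_zero fun h => ?_
    have := Walk.eq_of_length_eq_zero h
    tauto

lemma length_eq (hG : InGFamily ℓ G) : K.P1.length = K.P2.length ∧ K.Q1.length = K.Q2.length ∧
    K.L1.length = K.L2.length ∧ K.P1.length + K.Q1.length + K.L1.length = 2 * ℓ + 1 := by
  have h1 := hG.2 _ _ K.face1
  have h2 := hG.2 _ _ K.face2
  have h3 := hG.2 _ _ K.face3
  have h4 := hG.2 _ _ K.face4
  simp only [Walk.length_append, Walk.length_reverse] at h1 h2 h3 h4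
  omega

/-- Distinct arrises meet only in branch vertices, and each contains only its own two. -/
lemma mem_inter {a b c d : V} {p : G.Walk a b} {q : G.Walk c d} {z : V}
    (hp : z ∈ p.support) (hq : z ∈ q.support)
    (hpq : (interiorL p).Disjoint (interiorL q))
    (hpb : ∀ w ∈ interiorL p, w ≠ c ∧ w ≠ d) (hqb : ∀ w ∈ interiorL q, w ≠ a ∧ w ≠ b) :
    (z = a ∨ z = b) ∧ (z = c ∨ z = d) := by
  have h1 := fun h h' => Walk.mem_interiorL_of_mem_support (z := z) hp h h'
  have h2 := fun h h' => Walk.mem_interiorL_of_mem_support (z := z) hq h h'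
  have h3 := @hpq z
  grind

lemma arris_inter (z : V) :
    (z ∈ K.P1.support → z ∉ K.P2.support) ∧
    (z ∈ K.P1.support → z ∈ K.Q1.support → z = K.u2) ∧
    (z ∈ K.P1.support → z ∈ K.Q2.support → z = K.u1) ∧
    (z ∈ K.P1.support → z ∈ K.L1.support → z = K.u1) ∧
    (z ∈ K.P1.support → z ∈ K.L2.support → z = K.u2) ∧
    (z ∈ K.P2.support → z ∈ K.Q1.support → z = K.u3) ∧
    (z ∈ K.P2.support → z ∈ K.Q2.support → z = K.u4) ∧
    (z ∈ K.P2.support → z ∈ K.L1.support → z = K.u3) ∧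
    (z ∈ K.P2.support → z ∈ K.L2.support → z = K.u4) := by
  have hd := K.hdisj
  have hb := K.hbranch
  have := K.branch_ne
  simp only [List.pairwise_cons, List.mem_cons, List.mem_append, List.not_mem_nil] at hd hb
  refine ⟨?_, ?_, ?_, ?_, ?_, ?_, ?_, ?_, ?_⟩ <;>
  · intro h1 h2
    have := mem_inter h1 h2 (by grind) (by grind) (by grind)
    grind

end OddK4

namespace OddK4

variable {G : SimpleGraph V} (K : OddK4 G) {ℓ : ℕ}

lemma girth_le_add (hG : InGFamily ℓ G) : 2 * ℓ + 1 ≤ 2 * (K.Q1.length + K.L1.length) := by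
  have hP1 : ¬ K.P1.Nil := fun h => K.branch_ne.1 h.eq
  have hp := K.face1.1.1.isPath_of_append_right hP1
  have hq := K.face2.1.1.isPath_of_append_right hP1
  have hne : K.Q1.append K.L1.reverse ≠ K.L2.append K.Q2.reverse := by
    intro h
    have h3 : K.u3 ∈ (K.L2.append K.Q2.reverse).support := by rw [← h]; simp
    simp only [Walk.mem_support_append_iff, Walk.support_reverse, List.mem_reverse] at h3
    have := K.arris_inter K.u3
    have := K.branch_ne
    have := K.P2.start_mem_support
    grind
  obtain ⟨w, -, -, c, hc, hlen⟩ := hp.exists_isCycle_length_le_add_of_ne hq hne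
  have hle := egirth_le_length hc
  rw [hG.1] at hle
  have hle : 2 * ℓ + 1 ≤ c.length := by exact_mod_cast hle
  have := K.length_eq hG
  simp only [Walk.length_append, Walk.length_reverse] at hlen
  omega

/-- Girth alone rules out any edge from the interior of `P1` to the opposite arris `P2`. -/
lemma not_adj_of_mem_P1_of_mem_P2 (hℓ : 2 ≤ ℓ) (hG : InGFamily ℓ G) {s t : V}
    (hs : s ∈ K.P1.support) (ht : t ∈ K.P2.support) (hs1 : s ≠ K.u1) (hs2 : s ≠ K.u2) :
    ¬ G.Adj s t := by
  intro hst
  have girth_le : ∀ {a b : V} (h : G.Adj a b) (w : G.Walk b a), s(a, b) ∉ w.edges →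
      2 * ℓ + 1 ≤ w.length + 1 := fun h w hw => by
    have := Walk.egirth_le_of_adj h w hw
    rw [hG.1] at this
    exact_mod_cast this
  obtain ⟨A, B, hAB⟩ := Walk.mem_support_iff_exists_append.1 hs
  obtain ⟨C, D, hCD⟩ := Walk.mem_support_iff_exists_append.1 ht
  have hA : ∀ e ∈ A.edges, e ∈ K.P1.edges := by simp +contextual [hAB]
  have hB : ∀ e ∈ B.edges, e ∈ K.P1.edges := by simp +contextual [hAB]
  have hC : ∀ e ∈ C.edges, e ∈ K.P2.edges := by simp +contextual [hCD]
  have hD : ∀ e ∈ D.edges, e ∈ K.P2.edges := by simp +contextual [hCD]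
  have hlen1 := congrArg Walk.length hAB
  have hlen2 := congrArg Walk.length hCD
  rw [Walk.length_append] at hlen1 hlen2
  have hs' := K.arris_inter s
  have ht' := K.arris_inter t
  have eP1 : s(s, t) ∉ K.P1.edges := fun h => ht'.1 (Walk.snd_mem_support_of_mem_edges _ h) ht
  have eP2 : s(s, t) ∉ K.P2.edges := fun h => hs'.1 hs (Walk.fst_mem_support_of_mem_edges _ h)
  have eQ1 : s(s, t) ∉ K.Q1.edges := fun h => by
    grind [Walk.fst_mem_support_of_mem_edges _ h]
  have eQ2 : s(s, t) ∉ K.Q2.edges := fun h => by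
    grind [Walk.fst_mem_support_of_mem_edges _ h]
  have eL1 : s(s, t) ∉ K.L1.edges := fun h => by
    grind [Walk.fst_mem_support_of_mem_edges _ h]
  have eL2 : s(s, t) ∉ K.L2.edges := fun h => by
    grind [Walk.fst_mem_support_of_mem_edges _ h]
  have g1 := girth_le hst (C.reverse.append (K.L1.reverse.append A)) (by simp; grind)
  have g2 := girth_le hst (D.append (K.L2.reverse.append B.reverse)) (by simp; grind)
  have g3 := girth_le hst (D.append (K.Q2.reverse.append A)) (by simp; grind)
  have g4 := girth_le hst (C.reverse.append (K.Q1.reverse.append B.reverse)) (by simp; grind)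
  simp only [Walk.length_append, Walk.length_reverse] at g1 g2 g3 g4
  obtain ⟨l1, l2, l3, l4⟩ := K.length_eq hG
  have := K.girth_le_add hG
  have := K.length_pos
  omega

end OddK4

namespace IsInducedPath

variable {G : SimpleGraph V}

lemma append_append_of_adj {a b c d : V} {p : G.Walk a b} {q : G.Walk b c} {l : G.Walk a c}
    {t : G.Walk c d} (hpq : IsInducedPath G (p.append q)) (hqt : IsInducedPath G (q.append t))
    (hlt : IsInducedPath G (l.append t)) (hpt : ∀ z ∈ p.support, z ∉ t.support)
    (hl : ∀ z ∈ t.support, z ∈ l.support → z = c)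
    (hadj : ∀ w ∈ p.support, ∀ z ∈ t.support, G.Adj w z → w = a ∨ w = b) :
    IsInducedPath G ((p.append q).append t) := by
  refine hpq.append_append hqt hpt fun w hw z hz hwz => ?_
  rcases hadj w hw z hz hwz with rfl | h
  · have := hlt.2 w (by simp) z (by simp [hz]) hwz
    rw [Walk.edges_append, List.mem_append] at this
    rcases this with h | h
    · exact .inr (hl z hz (l.snd_mem_support_of_mem_edges h))
    · exact absurd (t.fst_mem_support_of_mem_edges h) (hpt w hw)
  · exact .inl h

/-- In a graph of `𝒢ℓ`, a path closing `r` to a hole forces a bound on the length of that hole,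
which is sharp when the hole is odd. -/
lemma length_of_closing {ℓ : ℕ} (hG : InGFamily ℓ G) {v1 v2 x y : V} {p : G.Walk v1 v2}
    {r : G.Walk x y}
    (hp : IsInducedPath G p) (hr : IsInducedPath G r) (hdisj : ∀ w ∈ p.support, w ∉ r.support)
    (hx : G.Adj x v1) (hy : G.Adj v2 y) (hlen : 2 ≤ r.length)
    (hadj : ∀ w ∈ p.support, ∀ z ∈ r.support, G.Adj w z → w = v1 ∧ z = x ∨ w = v2 ∧ z = y) :
    2 * ℓ + 1 ≤ p.length + 2 + r.length ∧
      ((p.length + 2 + r.length) % 2 = 1 → p.length + 2 + r.length = 2 * ℓ + 1) := by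
  have hc := hp.isHole_cons_append hr hdisj hx hy hlen hadj
  have hl : (Walk.cons hx (p.append (.cons hy r.reverse))).length = p.length + 2 + r.length := by
    simp only [Walk.length_cons, Walk.length_append, Walk.length_reverse]
    omega
  rw [← hl]
  refine ⟨?_, fun hodd => hG.2 _ _ ⟨hc, by rwa [Nat.odd_iff]⟩⟩
  have := egirth_le_length hc.1
  rw [hG.1] at this
  exact_mod_cast this

end IsInducedPath

/-- Claim 3.1: in the setup of the proof of Theorem 1.2,
the attachment vertex `x` is neither `u1` nor `u2`. -/
theorem claim_u1u2 {V : Type*}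
    (ℓ : ℕ) (hℓ : 5 ≤ ℓ) (G : SimpleGraph V)
    (hG : InGFamily ℓ G) (hcrit : VertexCritical 4 G)
    (K : OddK4 G) (hlong : K.longestPair)
    (e f : Sym2 V)
    (he : e = s(K.u3, K.P2.getVert 1))
    (hf : f = s(K.u4, K.P2.getVert (K.P2.length - 1)))
    (v1 v2 : V) (P : (G.deleteEdges {e, f}).Walk v1 v2)
    (hPind : IsInducedPath (G.deleteEdges {e, f}) P)
    (hPdisj : ∀ w ∈ P.support, w ∉ K.verts)
    (hv2nbr : ∃ z ∈ interiorL K.P2, (G.deleteEdges {e, f}).Adj v2 z)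
    (hv2only : ∀ w ∈ P.support,
      (∃ z ∈ interiorL K.P2, (G.deleteEdges {e, f}).Adj w z) → w = v2)
    (hv1nbr : ∃ z : V, z ∈ K.verts ∧ z ∉ interiorL K.P2 ∧ (G.deleteEdges {e, f}).Adj v1 z)
    (hv1only : ∀ w ∈ P.support,
      (∃ z : V, z ∈ K.verts ∧ z ∉ interiorL K.P2 ∧ (G.deleteEdges {e, f}).Adj w z) → w = v1)
    (x y : V)
    (hy : y ∈ interiorL K.P2) (hv2y : G.Adj v2 y)
    (hyuniq : ∀ z ∈ interiorL K.P2, G.Adj v2 z → z = y)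
    (hxH : x ∈ K.verts) (hxP2 : x ∉ interiorL K.P2) (hv1x : G.Adj v1 x)
    (hxuniq : ∀ z : V, z ∈ K.verts → z ∉ interiorL K.P2 → G.Adj v1 z → z = x)
    : x ≠ K.u1 ∧ x ≠ K.u2 := by
  obtain ⟨l1, l2, l3, l4⟩ := K.length_eq hG
  obtain ⟨p1, p2, p3, p4, p5, p6⟩ := K.length_pos
  have hyP2 := Walk.mem_support_of_mem_interiorL hy
  have hyb := K.hbranch y (by simp [hy])
  simp only [List.mem_cons, List.not_mem_nil, or_false, not_or] at hyb
  -- Outside `K`, deleting `e` and `f` changes no adjacency.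
  have hmem : ∀ n, K.P2.getVert n ∈ K.verts := fun n => by
    simp [K.mem_verts, K.P2.getVert_mem_support]
  have hu3 : K.u3 ∈ K.verts := by simp [K.mem_verts]
  have hu4 : K.u4 ∈ K.verts := by simp [K.mem_verts]
  have hdel : ∀ w ∈ P.support, ∀ z, G.Adj w z → (G.deleteEdges {e, f}).Adj w z := by
    intro w hw z hwz
    have h := hPdisj w hw
    rw [deleteEdges_adj]
    refine ⟨hwz, fun h' => h ?_⟩
    rw [Set.mem_insert_iff, Set.mem_singleton_iff, he, hf, Sym2.eq_iff, Sym2.eq_iff] at h'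
    grind
  have hle := G.deleteEdges_le {e, f}
  have hP : IsInducedPath G (P.mapLe hle) := by
    refine ⟨hPind.1.mapLe hle, fun a ha b hb hab => ?_⟩
    rw [Walk.support_mapLe_eq_support] at ha hb
    rw [Walk.edges_mapLe_eq_edges]
    exact hPind.2 a ha b hb (hdel a ha b hab)
  have hPH : ∀ w ∈ P.support, ∀ z ∈ K.verts, G.Adj w z → w = v1 ∧ z = x ∨ w = v2 ∧ z = y := by
    intro w hw z hz hwz
    by_cases hzP : z ∈ interiorL K.P2
    · obtain rfl := hv2only w hw ⟨z, hzP, hdel w hw z hwz⟩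
      exact .inr ⟨rfl, hyuniq z hzP hwz⟩
    · obtain rfl := hv1only w hw ⟨z, hz, hzP, hdel w hw z hwz⟩
      exact .inl ⟨rfl, hxuniq z hz hzP hwz⟩
  have closing : ∀ r : G.Walk x y, IsInducedPath G r → (∀ z ∈ r.support, z ∈ K.verts) →
      2 ≤ r.length → 2 * ℓ + 1 ≤ P.length + 2 + r.length ∧
        ((P.length + 2 + r.length) % 2 = 1 → P.length + 2 + r.length = 2 * ℓ + 1) := by
    intro r hr hrK hlen
    have := hP.length_of_closing hG hr (by simpa using fun w hw h => hPdisj w hw (hrK w h))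
      hv1x.symm hv2y hlen (by simpa using fun w hw z hz => hPH w hw z (hrK z hz))
    simpa only [Walk.mapLe, Walk.length_map] using this
  obtain ⟨T, D, hTD⟩ := Walk.mem_support_iff_exists_append.1 hyP2
  have hlen := congrArg Walk.length hTD
  rw [Walk.length_append] at hlen
  have hTpos : 0 < T.length :=
    Nat.pos_of_ne_zero fun h => hyb.2.2.1 (Walk.eq_of_length_eq_zero h).symm
  have hDpos : 0 < D.length :=
    Nat.pos_of_ne_zero fun h => hyb.2.2.2 (Walk.eq_of_length_eq_zero h)
  have hT : ∀ z ∈ T.support, z ∈ K.P2.support := by simp +contextual [hTD]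
  have hD : ∀ z ∈ D.reverse.support, z ∈ K.P2.support := by simp +contextual [hTD]
  have hK := K.arris_inter
  have hKv := fun z => K.mem_verts (z := z)
  have hadj : ∀ w ∈ K.P1.support, ∀ z ∈ K.P2.support, G.Adj w z → w = K.u1 ∨ w = K.u2 := by
    intro w hw z hz hwz
    by_contra! h
    exact K.not_adj_of_mem_P1_of_mem_P2 (by omega) hG hw hz h.1 h.2 hwz
  have hQL := K.girth_le_add hG
  have f1 := K.face1.1
  have f2 := K.face2.1
  have f3 := K.face3.1
  have f4 := K.face4.1
  have f1' := f1.reverse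
  have f2' := f2.reverse
  have f3' := f3.reverse
  have f4' := f4.reverse
  rw [hTD] at f3 f4 f3' f4'
  simp only [Walk.reverse_append, Walk.reverse_reverse] at f1' f2' f3' f4'
  replace f1' := f1'.append_comm
  replace f2' := f2'.append_comm
  simp only [Walk.append_assoc] at f1 f2 f1' f2' f3 f4 f3' f4'
  have iQT := IsHole.isInducedPath_left (p := K.Q1.append T) (q := D.append K.L2.reverse)
    (by simpa [Walk.append_assoc] using f4) (by simp; omega)
  have iLT := IsHole.isInducedPath_left (p := K.L1.append T) (q := D.append K.Q2.reverse)
    (by simpa [Walk.append_assoc] using f3) (by simp; omega)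
  have iQD := IsHole.isInducedPath_left (p := K.Q2.append D.reverse)
    (q := T.reverse.append K.L1.reverse) (by simpa [Walk.append_assoc] using f3') (by simp; omega)
  have iLD := IsHole.isInducedPath_left (p := K.L2.append D.reverse)
    (q := T.reverse.append K.Q1.reverse) (by simpa [Walk.append_assoc] using f4') (by simp; omega)
  have hadj' : ∀ w ∈ K.P1.reverse.support, ∀ z ∈ K.P2.support, G.Adj w z → w = K.u2 ∨ w = K.u1 :=
    fun w hw z hz hwz => (hadj w (by simpa using hw) z hz hwz).symm
  have hdisj : ∀ z ∈ K.P1.support, z ∉ K.P2.support := fun z => (hK z).1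
  have hdisj' : ∀ z ∈ K.P1.reverse.support, z ∉ K.P2.support := by simpa using hdisj
  constructor
  · rintro rfl
    have a1 := closing _ iLT (fun z hz => by
      rw [Walk.mem_support_append_iff] at hz; grind) (by simp; omega)
    have a2 := closing _ iQD (fun z hz => by
      rw [Walk.mem_support_append_iff] at hz; grind) (by simp; omega)
    have a3 : 2 ≤ K.L1.length → _ := fun h => closing _
      ((f1.isInducedPath_left (by simpa using h)).append_append_of_adj iQT iLT
        (fun z hz hz' => hdisj z hz (hT z hz')) (fun z hz => (hK z).2.2.2.2.2.2.2.1 (hT z hz))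
        (fun w hw z hz => hadj w hw z (hT z hz)))
      (fun z hz => by simp only [Walk.mem_support_append_iff] at hz; grind) (by simp; omega)
    have a4 : 2 ≤ K.Q2.length → _ := fun h => closing _
      ((f2.isInducedPath_left (by simpa using h)).append_append_of_adj iLD iQD
        (fun z hz hz' => hdisj z hz (hD z hz')) (fun z hz => (hK z).2.2.2.2.2.2.1 (hD z hz))
        (fun w hw z hz => hadj w hw z (hD z hz)))
      (fun z hz => by simp only [Walk.mem_support_append_iff] at hz; grind) (by simp; omega)
    simp only [Walk.length_append, Walk.length_reverse] at a1 a2 a3 a4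
    omega
  · rintro rfl
    have a1 := closing _ iQT (fun z hz => by
      rw [Walk.mem_support_append_iff] at hz; grind) (by simp; omega)
    have a2 := closing _ iLD (fun z hz => by
      rw [Walk.mem_support_append_iff] at hz; grind) (by simp; omega)
    have a3 : 2 ≤ K.Q1.length → _ := fun h => closing _
      ((f1'.isInducedPath_left (by simpa using h)).append_append_of_adj iLT iQT
        (fun z hz hz' => hdisj' z hz (hT z hz')) (fun z hz => (hK z).2.2.2.2.2.1 (hT z hz))
        (fun w hw z hz => hadj' w hw z (hT z hz)))
      (fun z hz => by
        simp only [Walk.mem_support_append_iff, Walk.support_reverse, List.mem_reverse] at hz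
        grind) (by simp; omega)
    have a4 : 2 ≤ K.L2.length → _ := fun h => closing _
      ((f2'.isInducedPath_left (by simpa using h)).append_append_of_adj iQD iLD
        (fun z hz hz' => hdisj' z hz (hD z hz')) (fun z hz => (hK z).2.2.2.2.2.2.2.2 (hD z hz))
        (fun w hw z hz => hadj' w hw z (hD z hz)))
      (fun z hz => by
        have := hD z
        simp only [Walk.mem_support_append_iff, Walk.support_reverse, List.mem_reverse] at hz this
        grind) (by simp; omega)
    simp only [Walk.length_append, Walk.length_reverse] at a1 a2 a3 a4
    omega
end
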